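/- For any real r > 0, there exists a constant C(r) > 0 such that for all Schwartz functions f, g on ℝ², all i ∈ {1,2}, and all ξ ∈ ℝ², we have |ξ_i|^r |𝔉(fg)(ξ)| ≤ C(r) (‖f‖_{L²} ‖|∂_i|^r g‖_{L²} + ‖g‖_{L²} ‖|∂_i|^r f‖_{L²}), where 𝔉 denotes the Fourier transform and ‖|∂_i|^r h‖_{L²} = ‖ |ξ_i|^r ĥ(ξ) ‖_{L²}. -/

import Mathlib

open MeasureTheory
open scoped FourierTransform

abbrev E2 := EuclideanSpace ℝ (Fin 2)

lemma aux_rpow {r : ℝ} (hr : 0 < r) (x y z : ℝ) (h : x = y + z) :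
    |x| ^ r ≤ 2 ^ r * (|y| ^ r + |z| ^ r) := by
  have hx : |x| ≤ 2 * max |y| |z| := by
    rw [h]
    linarith [abs_add_le y z, le_max_left |y| |z|, le_max_right |y| |z|]
  have h1 : |x| ^ r ≤ (2 * max |y| |z|) ^ r := Real.rpow_le_rpow (abs_nonneg _) hx hr.le
  rw [Real.mul_rpow (by norm_num) (by positivity)] at h1
  refine h1.trans ?_
  gcongr
  have hy : 0 ≤ |y| ^ r := by positivity
  have hz : 0 ≤ |z| ^ r := by positivity
  rcases max_choice |y| |z| with h | h <;> rw [h] <;> linarith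

lemma aux_memLp {r : ℝ} (hr : 0 < r) (F : SchwartzMap E2 ℂ) (i : Fin 2) :
    MemLp (fun η : E2 => |η i| ^ r * ‖F η‖) 2 volume := by
  have hg := Function.hasTemperateGrowth_one_add_norm_sq_rpow E2 r
  have hS := (SchwartzMap.smulLeftCLM ℂ (fun x : E2 => (1 + ‖x‖ ^ 2) ^ r) F).memLp 2 volume
  refine hS.mono ?_ (Filter.Eventually.of_forall fun x => ?_)
  · have : Continuous (fun η : E2 => |η i| ^ r * ‖F η‖) := by
      refine Continuous.mul (Continuous.rpow_const (by fun_prop) fun _ => Or.inr hr.le) ?_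
      exact F.continuous.norm
    exact this.aestronglyMeasurable
  · rw [SchwartzMap.smulLeftCLM_apply_apply hg, norm_smul, norm_mul, norm_norm]
    gcongr
    rw [Real.norm_of_nonneg (by positivity), Real.norm_of_nonneg (by positivity)]
    refine Real.rpow_le_rpow (abs_nonneg _) ?_ hr.le
    have := PiLp.norm_apply_le x i
    rw [Real.norm_eq_abs] at this
    nlinarith [sq_nonneg (‖x‖ - 1), norm_nonneg x]

lemma aux_cs {u v : E2 → ℝ} (hu : MemLp u 2 volume) (hv : MemLp v 2 volume)
    (hu0 : ∀ x, 0 ≤ u x) (hv0 : ∀ x, 0 ≤ v x) (ξ : E2) :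
    Integrable (fun t => u t * v (ξ - t)) ∧
    ∫ t, u t * v (ξ - t) ≤ (eLpNorm u 2 volume).toReal * (eLpNorm v 2 volume).toReal := by
  have hmp : MeasurePreserving (fun t : E2 => ξ - t) volume volume :=
    Measure.measurePreserving_sub_left volume ξ
  have hv' : MemLp (fun t => v (ξ - t)) 2 volume := hv.comp_measurePreserving hmp
  have hint : Integrable (fun t => u t * v (ξ - t)) := hu.integrable_mul hv'
  refine ⟨hint, ?_⟩
  have he : eLpNorm (fun t => v (ξ - t)) 2 volume = eLpNorm v 2 volume :=
    eLpNorm_comp_measurePreserving hv.1 hmp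
  have hh := eLpNorm_le_eLpNorm_mul_eLpNorm'_of_norm (p := 2) (q := 2) (r := 1) hu.1 hv'.1
    (fun a b => a * b) 1 (Filter.Eventually.of_forall fun x => by simp)
  rw [he, ENNReal.coe_one, one_mul] at hh
  have h1 := ENNReal.toReal_mono (ENNReal.mul_ne_top hu.2.ne hv.2.ne) hh
  rw [ENNReal.toReal_mul] at h1
  refine le_trans (le_of_eq ?_) h1
  rw [eLpNorm_one_eq_lintegral_enorm, ← integral_norm_eq_lintegral_enorm hint.1]
  refine integral_congr_ae (Filter.Eventually.of_forall fun x => ?_)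
  simp only []
  rw [Real.norm_of_nonneg (mul_nonneg (hu0 _) (hv0 _))]

lemma aux_conv (f g : SchwartzMap E2 ℂ) (ξ : E2) :
    𝓕 (fun x => f x * g x) ξ = ∫ t, 𝓕 f t * 𝓕 g (ξ - t) := by
  let P := SchwartzMap.pairing (ContinuousLinearMap.mul ℂ ℂ) f g
  let H := SchwartzMap.convolution (ContinuousLinearMap.mul ℂ ℂ) (𝓕 f) (𝓕 g)
  have hP : (P : E2 → ℂ) = fun x => f x * g x := rfl
  have key : ∀ (h : SchwartzMap E2 ℂ) (x : E2), 𝓕 h x = 𝓕⁻ h (-x) := by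
    intro h x
    rw [SchwartzMap.fourierInv_coe, SchwartzMap.fourier_coe, Real.fourierInv_eq_fourier_neg,
      neg_neg]
  have hH : 𝓕⁻ H = P := by
    ext x
    have := key H (-x)
    rw [neg_neg] at this
    rw [← this, SchwartzMap.fourier_convolution, SchwartzMap.pairing_apply_apply, key, key]
    simp [P]
  have h2 : 𝓕 P = H := by rw [← hH]; simp
  rw [← hP, ← SchwartzMap.fourier_coe, h2, SchwartzMap.convolution_apply]
  rfl

lemma aux_planch (f : SchwartzMap E2 ℂ) :
    (eLpNorm (fun x => ‖𝓕 f x‖) 2 volume).toReal = (eLpNorm (⇑f) 2 volume).toReal := by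
  have := SchwartzMap.norm_fourier_toL2_eq f
  rw [SchwartzMap.norm_toLp, SchwartzMap.norm_toLp] at this
  rw [← this, eLpNorm_norm]


/-- Lemma 2.5: for `r > 0` there is `C(r) > 0` such that for all Schwartz `f, g` on `ℝ²`,
`sup_ξ |ξ_i|^r |𝔉(fg)(ξ)| ≤ C(r)(‖f‖_{L²} ‖|∂_i|^r g‖_{L²} + ‖g‖_{L²} ‖|∂_i|^r f‖_{L²})`. -/
theorem stmt_0 (r : ℝ) (hr : 0 < r) :
    ∃ C : ℝ, 0 < C ∧
      ∀ (f g : SchwartzMap (EuclideanSpace ℝ (Fin 2)) ℂ) (i : Fin 2)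
        (ξ : EuclideanSpace ℝ (Fin 2)),
        |ξ i| ^ r * ‖𝓕 (fun x => f x * g x) ξ‖ ≤
          C * ((eLpNorm (⇑f) 2 volume).toReal *
                (eLpNorm (fun η : EuclideanSpace ℝ (Fin 2) => |η i| ^ r * ‖𝓕 (⇑g) η‖)
                  2 volume).toReal
              + (eLpNorm (⇑g) 2 volume).toReal *
                (eLpNorm (fun η : EuclideanSpace ℝ (Fin 2) => |η i| ^ r * ‖𝓕 (⇑f) η‖)
                  2 volume).toReal) := by
  refine ⟨2 ^ r, by positivity, fun f g i ξ => ?_⟩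
  rw [aux_conv, ← aux_planch f, ← aux_planch g, ← SchwartzMap.fourier_coe g,
    ← SchwartzMap.fourier_coe f]
  have hF := ((𝓕 f).memLp 2 volume).norm
  have hG := ((𝓕 g).memLp 2 volume).norm
  obtain ⟨i1, h1⟩ := aux_cs hF (aux_memLp hr (𝓕 g) i) (fun _ => by positivity)
    (fun _ => by positivity) ξ
  obtain ⟨i2, h2⟩ := aux_cs (aux_memLp hr (𝓕 f) i) hG (fun _ => by positivity)
    (fun _ => by positivity) ξ
  obtain ⟨i3, -⟩ := aux_cs hF hG (fun _ => by positivity) (fun _ => by positivity) ξ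
  calc |ξ i| ^ r * ‖∫ t, 𝓕 f t * 𝓕 g (ξ - t)‖
      ≤ |ξ i| ^ r * ∫ t, ‖𝓕 f t‖ * ‖𝓕 g (ξ - t)‖ := by
        gcongr
        refine (norm_integral_le_integral_norm _).trans (le_of_eq ?_)
        simp only [norm_mul]
    _ = ∫ t, |ξ i| ^ r * (‖𝓕 f t‖ * ‖𝓕 g (ξ - t)‖) := (integral_const_mul _ _).symm
    _ ≤ ∫ t, 2 ^ r * (‖𝓕 f t‖ * (|(ξ - t) i| ^ r * ‖𝓕 g (ξ - t)‖)
          + |t i| ^ r * ‖𝓕 f t‖ * ‖𝓕 g (ξ - t)‖) := by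
        refine integral_mono (i3.const_mul _) ((i1.add i2).const_mul _) fun t => ?_
        have h := aux_rpow hr (ξ i) ((ξ - t) i) (t i) (by simp)
        have h' := mul_le_mul_of_nonneg_right h
          (show 0 ≤ ‖𝓕 f t‖ * ‖𝓕 g (ξ - t)‖ by positivity)
        refine h'.trans (le_of_eq ?_)
        simp only []
        ring
    _ = 2 ^ r * ((∫ t, ‖𝓕 f t‖ * (|(ξ - t) i| ^ r * ‖𝓕 g (ξ - t)‖))
          + ∫ t, |t i| ^ r * ‖𝓕 f t‖ * ‖𝓕 g (ξ - t)‖) := by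
        rw [integral_const_mul, integral_add i1 i2]
    _ ≤ _ := by
        gcongr
        exact h2.trans (le_of_eq (mul_comm _ _))
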